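/- Let 𝔻̄ be the closed unit disk in ℝ², let c ∈ ℝ and let I ⊂ (−√2, √2) be a compact interval. There exists a constant C' > 0, depending only on c and I, such that for every continuous centered Gaussian field Γ on 𝔻̄ whose covariance kernel C satisfies C(z,w) ≤ −log|z−w| + c for all z ≠ w in 𝔻̄, every measurable f : 𝔻̄ → ℝ with |f| ≤ 1, and all γ, γ̃ ∈ I, one has E[(M^γ(Γ, f) − M^{γ̃}(Γ, f))²] ≤ C' |γ − γ̃|². -/

import Mathlib

open MeasureTheory ProbabilityTheory Real

/-- A continuous centered Gaussian field on a set `K ⊂ ℝ²` (modelled by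
`EuclideanSpace ℝ (Fin 2)`), with covariance kernel `C`. -/
def IsContGaussianField {Ω : Type*} [MeasureSpace Ω]
    (K : Set (EuclideanSpace ℝ (Fin 2)))
    (Γ : Ω → EuclideanSpace ℝ (Fin 2) → ℝ)
    (C : EuclideanSpace ℝ (Fin 2) → EuclideanSpace ℝ (Fin 2) → ℝ) : Prop :=
  Measurable (Function.uncurry Γ) ∧
  (∀ᵐ ω ∂(ℙ : Measure Ω), ContinuousOn (Γ ω) K) ∧
  (∀ (n : ℕ) (a : Fin n → ℝ) (z : Fin n → EuclideanSpace ℝ (Fin 2)), (∀ j, z j ∈ K) →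
    ∃ v : NNReal,
      Measure.map (fun ω => ∑ j, a j * Γ ω (z j)) (ℙ : Measure Ω) = gaussianReal 0 v) ∧
  (∀ z ∈ K, ∀ w ∈ K, C z w = ∫ ω, Γ ω z * Γ ω w) ∧
  ContinuousOn (fun p : EuclideanSpace ℝ (Fin 2) × EuclideanSpace ℝ (Fin 2) => C p.1 p.2)
    (K ×ˢ K)

/-- The approximate GMC integral `M^γ(Γ, f) = ∫_K f(z) exp(γ Γ(z) − (γ²/2) C(z,z)) dz`
of a sample path `g = Γ(ω, ·)`. -/
noncomputable def gmc (K : Set (EuclideanSpace ℝ (Fin 2))) (γ : ℝ)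
    (C : EuclideanSpace ℝ (Fin 2) → EuclideanSpace ℝ (Fin 2) → ℝ)
    (g : EuclideanSpace ℝ (Fin 2) → ℝ) (f : EuclideanSpace ℝ (Fin 2) → ℝ) : ℝ :=
  ∫ z in K, f z * Real.exp (γ * g z - γ ^ 2 / 2 * C z z)

/-- The polarized second moment `e^{γ²t} + e^{γ'²t} - 2e^{γγ't}` of the increment of the
normalized exponentials of two Gaussians with covariance `t`. -/
noncomputable def expIncrement (γ γ' t : ℝ) : ℝ :=
  exp (γ ^ 2 * t) + exp (γ' ^ 2 * t) - 2 * exp (γ * γ' * t)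

lemma sq_sub_exp_sq_le {m t B x y : ℝ} (hm : 0 ≤ m)
    (hB : ∀ x : ℝ, x ^ 2 ≤ m → t ^ 2 * x ^ 2 * exp (t * x ^ 2) ≤ B)
    (hx : x ^ 2 ≤ m) (hy : y ^ 2 ≤ m) :
    (exp (t * x ^ 2 / 2) - exp (t * y ^ 2 / 2)) ^ 2 ≤ B * (x - y) ^ 2 := by
  have hB0 : 0 ≤ B := by simpa using hB 0 (by simpa using hm)
  have hmem : ∀ z : ℝ, z ^ 2 ≤ m ↔ z ∈ Set.Icc (-√m) √m := fun z => by
    rw [Real.sq_le hm, Set.mem_Icc]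
  have hder : ∀ z ∈ Set.Icc (-√m) √m, HasDerivWithinAt (fun u : ℝ => exp (t * u ^ 2 / 2))
      (t * z * exp (t * z ^ 2 / 2)) (Set.Icc (-√m) √m) z := fun z _ => by
    have h : HasDerivAt (fun u : ℝ => t * u ^ 2 / 2) (t * z) z := by
      refine (((hasDerivAt_pow 2 z).const_mul t).div_const 2).congr_deriv ?_
      norm_num
      ring
    exact (h.exp.congr_deriv (mul_comm _ _)).hasDerivWithinAt
  have hbound : ∀ z ∈ Set.Icc (-√m) √m, ‖t * z * exp (t * z ^ 2 / 2)‖ ≤ √B := fun z hz => by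
    rw [Real.norm_eq_abs]
    refine Real.abs_le_sqrt ?_
    refine le_trans (le_of_eq ?_) (hB z ((hmem z).2 hz))
    rw [mul_pow, mul_pow, ← Real.exp_nat_mul]
    congr 2
    push_cast
    ring
  have h := (convex_Icc (-√m) √m).norm_image_sub_le_of_norm_hasDerivWithin_le hder hbound
    ((hmem y).1 hy) ((hmem x).1 hx)
  rw [Real.norm_eq_abs, Real.norm_eq_abs] at h
  calc _ = |exp (t * x ^ 2 / 2) - exp (t * y ^ 2 / 2)| ^ 2 := (sq_abs _).symm
    _ ≤ (√B * |x - y|) ^ 2 := by gcongr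
    _ = B * (x - y) ^ 2 := by rw [mul_pow, Real.sq_sqrt hB0, sq_abs]

lemma expIncrement_eq (γ γ' t : ℝ) :
    expIncrement γ γ' t = (exp (t * γ ^ 2 / 2) - exp (t * γ' ^ 2 / 2)) ^ 2 +
      2 * (exp ((γ ^ 2 + γ' ^ 2) * t / 2) - exp (γ * γ' * t)) := by
  have h1 : exp (γ ^ 2 * t) = exp (t * γ ^ 2 / 2) ^ 2 := by
    rw [← Real.exp_nat_mul]; congr 1; push_cast; ring
  have h2 : exp (γ' ^ 2 * t) = exp (t * γ' ^ 2 / 2) ^ 2 := by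
    rw [← Real.exp_nat_mul]; congr 1; push_cast; ring
  have h3 : exp ((γ ^ 2 + γ' ^ 2) * t / 2) = exp (t * γ ^ 2 / 2) * exp (t * γ' ^ 2 / 2) := by
    rw [← Real.exp_add]; congr 1; ring
  rw [expIncrement, h1, h2, h3]
  ring

lemma abs_expIncrement_le_of_nonpos {γ γ' t : ℝ} (h : 0 ≤ γ * γ') (ht : t ≤ 0) :
    |expIncrement γ γ' t| ≤ (γ - γ') ^ 2 * (-t) := by
  have hsq : (exp (t * γ ^ 2 / 2) - exp (t * γ' ^ 2 / 2)) ^ 2 ≤ -t * (γ - γ') ^ 2 := by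
    refine sq_sub_exp_sq_le (m := max (γ ^ 2) (γ' ^ 2)) (le_max_of_le_left (sq_nonneg _))
      (fun x _ => ?_) (le_max_left _ _) (le_max_right _ _)
    have h1 : -(t * x ^ 2) * exp (t * x ^ 2) ≤ 1 := by
      have h2 := Real.add_one_le_exp (-(t * x ^ 2))
      have h3 : exp (-(t * x ^ 2)) * exp (t * x ^ 2) = 1 := by rw [← Real.exp_add]; simp
      nlinarith [Real.exp_pos (t * x ^ 2)]
    nlinarith
  have h1 : exp ((γ ^ 2 + γ' ^ 2) * t / 2) = exp (γ * γ' * t) * exp ((γ - γ') ^ 2 * t / 2) := by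
    rw [← Real.exp_add]; congr 1; ring
  have h2 : exp (γ * γ' * t) ≤ 1 :=
    Real.exp_le_one_iff.2 (mul_nonpos_of_nonneg_of_nonpos h ht)
  have h3 := Real.add_one_le_exp ((γ - γ') ^ 2 * t / 2)
  have h4 : exp ((γ - γ') ^ 2 * t / 2) ≤ 1 :=
    Real.exp_le_one_iff.2 (by nlinarith [sq_nonneg (γ - γ')])
  have h5 := Real.exp_pos (γ * γ' * t)
  rw [expIncrement_eq, h1, abs_le]
  constructor
  · nlinarith [sq_nonneg (exp (t * γ ^ 2 / 2) - exp (t * γ' ^ 2 / 2)),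
      mul_nonneg (sub_nonneg.2 h2) (sub_nonneg.2 h4)]
  · nlinarith [mul_nonneg h5.le (sub_nonneg.2 h4)]

lemma abs_expIncrement_le_of_nonneg {m γ γ' t : ℝ} (hγ : γ ^ 2 ≤ m) (hγ' : γ' ^ 2 ≤ m)
    (ht : 0 ≤ t) :
    |expIncrement γ γ' t| ≤ (γ - γ') ^ 2 * ((t + m * t ^ 2) * exp (m * t)) := by
  have hm : 0 ≤ m := (sq_nonneg _).trans hγ
  have hsq : (exp (t * γ ^ 2 / 2) - exp (t * γ' ^ 2 / 2)) ^ 2 ≤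
      (t ^ 2 * m * exp (m * t)) * (γ - γ') ^ 2 := by
    refine sq_sub_exp_sq_le hm (fun x hx => ?_) hγ hγ'
    rw [mul_comm m t]
    gcongr
  have h1 : exp (γ * γ' * t) =
      exp ((γ ^ 2 + γ' ^ 2) * t / 2) * exp (-((γ - γ') ^ 2 * t / 2)) := by
    rw [← Real.exp_add]; congr 1; ring
  have h2 : exp ((γ ^ 2 + γ' ^ 2) * t / 2) ≤ exp (m * t) := by
    refine Real.exp_le_exp.2 ?_
    nlinarith
  have h3 := Real.add_one_le_exp (-((γ - γ') ^ 2 * t / 2))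
  have h6 : 0 ≤ (γ - γ') ^ 2 * t / 2 := by positivity
  have h4 : exp (-((γ - γ') ^ 2 * t / 2)) ≤ 1 := Real.exp_le_one_iff.2 (by linarith)
  have h5 := Real.exp_pos ((γ ^ 2 + γ' ^ 2) * t / 2)
  have h7 : 0 ≤ exp ((γ ^ 2 + γ' ^ 2) * t / 2) - exp (γ * γ' * t) := by
    rw [h1]; nlinarith
  rw [expIncrement_eq, abs_of_nonneg (by positivity)]
  have h8 : exp ((γ ^ 2 + γ' ^ 2) * t / 2) - exp (γ * γ' * t) ≤
      exp (m * t) * ((γ - γ') ^ 2 * t / 2) := by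
    rw [h1]
    calc _ = exp ((γ ^ 2 + γ' ^ 2) * t / 2) * (1 - exp (-((γ - γ') ^ 2 * t / 2))) := by ring
      _ ≤ _ := by gcongr; linarith
  linarith

/-- If `|γ|, |γ'| ≤ √m`, then up to a constant the increment is controlled by
`(γ - γ')²` times the negative part of `t` plus an exponential of `p > m` times its positive
part. -/
lemma exists_abs_expIncrement_le {m p : ℝ} (hm : 0 ≤ m) (hmp : m < p) :
    ∃ K : ℝ, 0 < K ∧ ∀ γ γ' t N : ℝ, γ ^ 2 ≤ m → γ' ^ 2 ≤ m → 0 ≤ γ * γ' →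
      1 ≤ N → exp (p * t) ≤ N →
      |expIncrement γ γ' t| ≤ (γ - γ') ^ 2 * (-t + K * N) := by
  have hp : 0 < p := hm.trans_lt hmp
  have hq : 0 < p - m := sub_pos.2 hmp
  refine ⟨1 / p + (1 / (p - m) + 2 * m / (p - m) ^ 2), by positivity,
    fun γ γ' t N hγ hγ' h hN htN => ?_⟩
  rcases le_total t 0 with ht | ht
  · refine (abs_expIncrement_le_of_nonpos h ht).trans ?_
    gcongr
    have : 0 ≤ (1 / p + (1 / (p - m) + 2 * m / (p - m) ^ 2)) * N := by positivity
    linarith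
  · refine (abs_expIncrement_le_of_nonneg hγ hγ' ht).trans ?_
    gcongr
    have h1 : t ≤ 1 / p * exp (p * t) := by
      have := Real.add_one_le_exp (p * t)
      rw [one_div, ← div_eq_inv_mul, le_div_iff₀ hp]
      linarith
    have h2 : t + m * t ^ 2 ≤ (1 / (p - m) + 2 * m / (p - m) ^ 2) * exp ((p - m) * t) := by
      have := Real.quadratic_le_exp_of_nonneg (mul_nonneg hq.le ht)
      have h3 : t ≤ 1 / (p - m) * exp ((p - m) * t) := by
        rw [one_div, ← div_eq_inv_mul, le_div_iff₀ hq]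
        nlinarith [mul_nonneg hq.le ht]
      have h4 : m * t ^ 2 ≤ 2 * m / (p - m) ^ 2 * exp ((p - m) * t) := by
        calc m * t ^ 2 = 2 * m / (p - m) ^ 2 * (((p - m) * t) ^ 2 / 2) := by field_simp
          _ ≤ _ := by gcongr; nlinarith [mul_nonneg hq.le ht]
      linarith
    have h3 : (t + m * t ^ 2) * exp (m * t) ≤
        (1 / (p - m) + 2 * m / (p - m) ^ 2) * exp (p * t) := by
      calc _ ≤ (1 / (p - m) + 2 * m / (p - m) ^ 2) * exp ((p - m) * t) * exp (m * t) := by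
            gcongr
        _ = _ := by rw [mul_assoc, ← Real.exp_add]; congr 2; ring
    have h4 : (1 / p + (1 / (p - m) + 2 * m / (p - m) ^ 2)) * exp (p * t) ≤
        (1 / p + (1 / (p - m) + 2 * m / (p - m) ^ 2)) * N := by gcongr
    linarith

/-- Second moment of the integral of a random field, in terms of its covariances. -/
lemma integral_sq_integral_eq {Ω E : Type*} [MeasurableSpace Ω] [MeasurableSpace E]
    {P : Measure Ω} [IsProbabilityMeasure P] {μ : Measure E} [IsFiniteMeasure μ]
    {H : Ω → E → ℝ} {B : ℝ}
    (hH : AEStronglyMeasurable (Function.uncurry H) (P.prod μ))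
    (hint : ∀ᵐ q ∂(μ.prod μ), Integrable (fun ω => H ω q.1 * H ω q.2) P)
    (hB : ∀ᵐ z ∂μ, Integrable (fun ω => H ω z ^ 2) P ∧ ∫ ω, H ω z ^ 2 ∂P ≤ B) :
    Integrable (fun ω => (∫ z, H ω z ∂μ) ^ 2) P ∧
    Integrable (fun q : E × E => ∫ ω, H ω q.1 * H ω q.2 ∂P) (μ.prod μ) ∧
    ∫ ω, (∫ z, H ω z ∂μ) ^ 2 ∂P = ∫ q : E × E, (∫ ω, H ω q.1 * H ω q.2 ∂P) ∂(μ.prod μ) := by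
  have hswap : AEStronglyMeasurable (fun q : E × Ω => H q.2 q.1) (μ.prod P) := hH.prod_swap
  have hmeas1 : AEStronglyMeasurable (fun q : (E × E) × Ω => H q.2 q.1.1) ((μ.prod μ).prod P) :=
    hswap.comp_quasiMeasurePreserving
      (QuasiMeasurePreserving.prodMap Measure.quasiMeasurePreserving_fst
        (Measure.QuasiMeasurePreserving.id _))
  have hmeas2 : AEStronglyMeasurable (fun q : (E × E) × Ω => H q.2 q.1.2) ((μ.prod μ).prod P) :=
    hswap.comp_quasiMeasurePreserving
      (QuasiMeasurePreserving.prodMap Measure.quasiMeasurePreserving_snd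
        (Measure.QuasiMeasurePreserving.id _))
  have hmeas := hmeas1.mul hmeas2
  have hBz := Measure.quasiMeasurePreserving_fst (μ := μ) (ν := μ) |>.ae hB
  have hBw := Measure.quasiMeasurePreserving_snd (μ := μ) (ν := μ) |>.ae hB
  have hL : Integrable (fun q : (E × E) × Ω => H q.2 q.1.1 * H q.2 q.1.2) ((μ.prod μ).prod P) := by
    refine (integrable_prod_iff hmeas).2 ⟨hint, ?_⟩
    · refine Integrable.mono' (integrable_const B) hmeas.norm.integral_prod_right' ?_
      filter_upwards [hBz, hBw] with q h1 h2
      rw [Real.norm_of_nonneg (integral_nonneg fun _ => norm_nonneg _)]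
      calc _ ≤ ∫ ω, (H ω q.1 ^ 2 + H ω q.2 ^ 2) / 2 ∂P := by
            refine integral_mono_of_nonneg (.of_forall fun _ => norm_nonneg _)
              ((h1.1.add h2.1).div_const 2) (.of_forall fun ω => ?_)
            simp only [Pi.mul_apply, norm_mul, Real.norm_eq_abs]
            nlinarith [sq_nonneg (|H ω q.1| - |H ω q.2|), sq_abs (H ω q.1), sq_abs (H ω q.2)]
        _ ≤ B := by
            rw [integral_div, integral_add h1.1 h2.1]
            linarith [h1.2, h2.2]
  have hsq : ∀ ω, (∫ z, H ω z ∂μ) ^ 2 = ∫ q : E × E, H ω q.1 * H ω q.2 ∂(μ.prod μ) := fun ω => by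
    rw [integral_prod_mul, sq]
  simp_rw [hsq]
  exact ⟨hL.integral_prod_right, hL.integral_prod_left, (integral_integral_swap hL).symm⟩

lemma integrableOn_norm_rpow_neg_ball {p : ℝ} (hp : p < 2) (r : ℝ) :
    IntegrableOn (fun x : EuclideanSpace ℝ (Fin 2) => ‖x‖ ^ (-p)) (Metric.ball 0 r) := by
  rw [integrableOn_fun_norm_addHaar volume (f := fun y : ℝ => y ^ (-p))]
  have h := (intervalIntegral.intervalIntegrable_rpow' (a := 0) (b := r)
    (show -1 < 1 - p by linarith)).1
  refine (h.mono_set Set.Ioo_subset_Ioc_self).congr_fun (fun y hy => ?_) measurableSet_Ioo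
  simp only [finrank_euclideanSpace, Fintype.card_fin, smul_eq_mul]
  rw [sub_eq_add_neg, Real.rpow_add hy.1]
  simp

/-- The kernel `dist z w ^ (-p)` is integrable on the square of the unit disk for `p < 2`. -/
lemma integrable_dist_rpow_neg_closedBall {p : ℝ} (hp : p < 2) :
    Integrable (fun q : EuclideanSpace ℝ (Fin 2) × EuclideanSpace ℝ (Fin 2) =>
        dist q.1 q.2 ^ (-p))
      ((volume.restrict (Metric.closedBall 0 1)).prod (volume.restrict (Metric.closedBall 0 1))) := by
  have h1 : Integrable ((Metric.closedBall (0 : EuclideanSpace ℝ (Fin 2)) 1).indicator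
      fun _ => (1 : ℝ)) :=
    (integrable_indicator_iff measurableSet_closedBall).2
      (integrableOn_const (isCompact_closedBall _ _).measure_ne_top)
  have h2 := (integrable_indicator_iff measurableSet_ball).2
    (integrableOn_norm_rpow_neg_ball hp 3)
  have h3 := h1.convolution_integrand (ContinuousLinearMap.mul ℝ ℝ) h2
  rw [Measure.prod_restrict]
  refine (h3.integrableOn (s := Metric.closedBall 0 1 ×ˢ Metric.closedBall 0 1)).congr_fun
    (fun q hq => ?_) (measurableSet_closedBall.prod measurableSet_closedBall)
  have hz := hq.1
  have hw := hq.2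
  have hd : q.1 - q.2 ∈ Metric.ball (0 : EuclideanSpace ℝ (Fin 2)) 3 := by
    rw [mem_closedBall_zero_iff] at hz hw
    rw [mem_ball_zero_iff]
    linarith [norm_sub_le q.1 q.2]
  simp [Set.indicator_of_mem hw, Set.indicator_of_mem hd, dist_eq_norm]

namespace IsContGaussianField

variable {Ω : Type*} [MeasureSpace Ω] {K : Set (EuclideanSpace ℝ (Fin 2))}
  {Γ : Ω → EuclideanSpace ℝ (Fin 2) → ℝ}
  {C : EuclideanSpace ℝ (Fin 2) → EuclideanSpace ℝ (Fin 2) → ℝ}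
  {z w : EuclideanSpace ℝ (Fin 2)}

lemma measurable_eval (h : IsContGaussianField K Γ C) (z : EuclideanSpace ℝ (Fin 2)) :
    Measurable fun ω => Γ ω z :=
  h.1.comp measurable_prodMk_right

lemma memLp_two (h : IsContGaussianField K Γ C) (hz : z ∈ K) :
    MemLp (fun ω => Γ ω z) 2 (ℙ : Measure Ω) := by
  obtain ⟨v, hv⟩ := h.2.2.1 1 ![1] ![z] (by simpa using hz)
  simp only [Fin.sum_univ_one, Matrix.cons_val_fin_one, one_mul] at hv
  have := memLp_id_gaussianReal' (μ := 0) (v := v) 2 (by simp)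
  rw [← hv, memLp_map_measure_iff (by fun_prop) (h.measurable_eval z).aemeasurable] at this
  exact this

lemma map_add (h : IsContGaussianField K Γ C) (hz : z ∈ K) (hw : w ∈ K) (α β : ℝ) :
    ∃ v : NNReal, Measure.map (fun ω => α * Γ ω z + β * Γ ω w) (ℙ : Measure Ω) = gaussianReal 0 v ∧
      (v : ℝ) = α ^ 2 * C z z + 2 * (α * β) * C z w + β ^ 2 * C w w := by
  obtain ⟨v, hv⟩ := h.2.2.1 2 ![α, β] ![z, w] (by
    intro j; fin_cases j <;> simpa)
  simp only [Fin.sum_univ_two, Matrix.cons_val_zero, Matrix.cons_val_one,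
    Matrix.cons_val_fin_one] at hv
  refine ⟨v, hv, ?_⟩
  have hX := h.memLp_two hz
  have hY := h.memLp_two hw
  have hmz := h.measurable_eval z
  have hmw := h.measurable_eval w
  have hvar : (v : ℝ) = ∫ x, x ^ 2 ∂(gaussianReal 0 v) := by
    rw [← variance_of_integral_eq_zero (X := fun x => x) (by fun_prop) (by simp),
      variance_fun_id_gaussianReal]
  have hXX : Integrable (fun ω => α ^ 2 * (Γ ω z * Γ ω z)) (ℙ : Measure Ω) :=
    (hX.integrable_mul hX).const_mul _
  have hXY : Integrable (fun ω => 2 * (α * β) * (Γ ω z * Γ ω w)) (ℙ : Measure Ω) :=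
    (hX.integrable_mul hY).const_mul _
  have hYY : Integrable (fun ω => β ^ 2 * (Γ ω w * Γ ω w)) (ℙ : Measure Ω) :=
    (hY.integrable_mul hY).const_mul _
  rw [hvar, ← hv, integral_map (by fun_prop) (by fun_prop), h.2.2.2.1 z hz z hz,
    h.2.2.2.1 z hz w hw, h.2.2.2.1 w hw w hw, ← integral_const_mul, ← integral_const_mul,
    ← integral_const_mul, ← integral_add hXX hXY, ← integral_add (by exact hXX.add hXY) hYY]
  congr 1 with ω
  ring

lemma integrable_exp_mul_exp [IsProbabilityMeasure (ℙ : Measure Ω)]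
    (h : IsContGaussianField K Γ C) (hz : z ∈ K) (hw : w ∈ K) (α β : ℝ) :
    Integrable (fun ω => exp (α * Γ ω z - α ^ 2 / 2 * C z z) *
      exp (β * Γ ω w - β ^ 2 / 2 * C w w)) (ℙ : Measure Ω) ∧
    ∫ ω, exp (α * Γ ω z - α ^ 2 / 2 * C z z) * exp (β * Γ ω w - β ^ 2 / 2 * C w w) =
      exp (α * β * C z w) := by
  obtain ⟨v, hv, hv'⟩ := h.map_add hz hw α β
  have hmz := h.measurable_eval z
  have hmw := h.measurable_eval w
  have heq : ∀ ω, exp (α * Γ ω z - α ^ 2 / 2 * C z z) * exp (β * Γ ω w - β ^ 2 / 2 * C w w) =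
      exp (-(α ^ 2 / 2 * C z z + β ^ 2 / 2 * C w w)) *
        exp (1 * (α * Γ ω z + β * Γ ω w)) := fun ω => by
    rw [← Real.exp_add, ← Real.exp_add]; congr 1; ring
  simp_rw [heq]
  constructor
  · refine Integrable.const_mul ?_ _
    have := integrable_exp_mul_gaussianReal (μ := 0) (v := v) 1
    rw [← hv, integrable_map_measure (by fun_prop) (by fun_prop)] at this
    exact this
  · have := mgf_gaussianReal hv 1
    rw [mgf] at this
    rw [integral_const_mul, this, ← Real.exp_add, hv']
    congr 1
    ring

lemma exists_abs_diag_le (h : IsContGaussianField K Γ C) (hK : IsCompact K) :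
    ∃ B, ∀ z ∈ K, |C z z| ≤ B := by
  obtain ⟨B, hB⟩ := (hK.prod hK).exists_bound_of_continuousOn h.2.2.2.2
  exact ⟨B, fun z hz => hB (z, z) ⟨hz, hz⟩⟩

lemma continuousOn_diag (h : IsContGaussianField K Γ C) : ContinuousOn (fun z => C z z) K :=
  h.2.2.2.2.comp (f := fun z => (z, z)) (by fun_prop) fun _ hz => ⟨hz, hz⟩

/-- Positivity of the covariance, integrated over the domain. -/
lemma integral_cov_nonneg [IsProbabilityMeasure (ℙ : Measure Ω)]
    (h : IsContGaussianField K Γ C) (hK : IsCompact K) :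
    Integrable (fun q : EuclideanSpace ℝ (Fin 2) × EuclideanSpace ℝ (Fin 2) => C q.1 q.2)
      ((volume.restrict K).prod (volume.restrict K)) ∧
    0 ≤ ∫ q : EuclideanSpace ℝ (Fin 2) × EuclideanSpace ℝ (Fin 2), C q.1 q.2
      ∂((volume.restrict K).prod (volume.restrict K)) := by
  have hfin : IsFiniteMeasure (volume.restrict K) :=
    isFiniteMeasure_restrict.2 hK.measure_ne_top
  obtain ⟨B, hB⟩ := h.exists_abs_diag_le hK
  have hmem : ∀ᵐ q ∂((volume.restrict K).prod (volume.restrict K)), q ∈ K ×ˢ K := by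
    rw [Measure.prod_restrict]
    exact ae_restrict_mem (hK.measurableSet.prod hK.measurableSet)
  obtain ⟨-, h2, h3⟩ := integral_sq_integral_eq (P := (ℙ : Measure Ω)) (μ := volume.restrict K)
    (H := Γ) (B := B) h.1.aestronglyMeasurable
    (hmem.mono fun q hq => (h.memLp_two hq.1).integrable_mul (h.memLp_two hq.2))
    ((ae_restrict_mem hK.measurableSet).mono fun z hz => ⟨(h.memLp_two hz).integrable_sq, by
      simp_rw [sq]
      rw [← h.2.2.2.1 z hz z hz]
      exact (le_abs_self _).trans (hB z hz)⟩)
  have hC : (fun q : EuclideanSpace ℝ (Fin 2) × EuclideanSpace ℝ (Fin 2) =>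
      ∫ ω, Γ ω q.1 * Γ ω q.2) =ᵐ[(volume.restrict K).prod (volume.restrict K)]
      fun q => C q.1 q.2 :=
    hmem.mono fun q hq => (h.2.2.2.1 q.1 hq.1 q.2 hq.2).symm
  refine ⟨h2.congr hC, ?_⟩
  rw [← integral_congr_ae hC, ← h3]
  exact integral_nonneg fun _ => sq_nonneg _

lemma integrable_increment_mul_increment [IsProbabilityMeasure (ℙ : Measure Ω)]
    (h : IsContGaussianField K Γ C) (hz : z ∈ K) (hw : w ∈ K) (γ γ' x y : ℝ) :
    Integrable (fun ω =>
      x * (exp (γ * Γ ω z - γ ^ 2 / 2 * C z z) - exp (γ' * Γ ω z - γ' ^ 2 / 2 * C z z)) *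
      (y * (exp (γ * Γ ω w - γ ^ 2 / 2 * C w w) - exp (γ' * Γ ω w - γ' ^ 2 / 2 * C w w))))
      (ℙ : Measure Ω) ∧
    ∫ ω, x * (exp (γ * Γ ω z - γ ^ 2 / 2 * C z z) - exp (γ' * Γ ω z - γ' ^ 2 / 2 * C z z)) *
      (y * (exp (γ * Γ ω w - γ ^ 2 / 2 * C w w) - exp (γ' * Γ ω w - γ' ^ 2 / 2 * C w w))) =
      x * y * expIncrement γ γ' (C z w) := by
  obtain ⟨i1, e1⟩ := h.integrable_exp_mul_exp hz hw γ γ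
  obtain ⟨i2, e2⟩ := h.integrable_exp_mul_exp hz hw γ γ'
  obtain ⟨i3, e3⟩ := h.integrable_exp_mul_exp hz hw γ' γ
  obtain ⟨i4, e4⟩ := h.integrable_exp_mul_exp hz hw γ' γ'
  have heq : ∀ ω,
      x * (exp (γ * Γ ω z - γ ^ 2 / 2 * C z z) - exp (γ' * Γ ω z - γ' ^ 2 / 2 * C z z)) *
      (y * (exp (γ * Γ ω w - γ ^ 2 / 2 * C w w) - exp (γ' * Γ ω w - γ' ^ 2 / 2 * C w w))) =
      x * y * (exp (γ * Γ ω z - γ ^ 2 / 2 * C z z) * exp (γ * Γ ω w - γ ^ 2 / 2 * C w w) +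
        exp (γ' * Γ ω z - γ' ^ 2 / 2 * C z z) * exp (γ' * Γ ω w - γ' ^ 2 / 2 * C w w) -
        (exp (γ * Γ ω z - γ ^ 2 / 2 * C z z) * exp (γ' * Γ ω w - γ' ^ 2 / 2 * C w w) +
        exp (γ' * Γ ω z - γ' ^ 2 / 2 * C z z) * exp (γ * Γ ω w - γ ^ 2 / 2 * C w w))) :=
    fun ω => by ring
  simp_rw [heq]
  refine ⟨((i1.add i4).sub (i2.add i3)).const_mul _, ?_⟩
  rw [integral_const_mul, integral_sub (by exact i1.add i4) (by exact i2.add i3),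
    integral_add i1 i4, integral_add i2 i3, e1, e2, e3, e4, expIncrement, mul_comm γ' γ,
    ← sq, ← sq]
  ring

lemma gmc_sub_gmc_ae_eq (h : IsContGaussianField K Γ C) (hK : IsCompact K)
    {f : EuclideanSpace ℝ (Fin 2) → ℝ} (hf : Measurable f) (hf1 : ∀ z, |f z| ≤ 1) (γ γ' : ℝ) :
    ∀ᵐ ω ∂(ℙ : Measure Ω), gmc K γ C (Γ ω) f - gmc K γ' C (Γ ω) f =
      ∫ z in K, f z *
        (exp (γ * Γ ω z - γ ^ 2 / 2 * C z z) - exp (γ' * Γ ω z - γ' ^ 2 / 2 * C z z)) := by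
  filter_upwards [h.2.1] with ω hω
  have hd := h.continuousOn_diag
  have hint : ∀ γ : ℝ, IntegrableOn (fun z => f z * exp (γ * Γ ω z - γ ^ 2 / 2 * C z z)) K :=
    fun γ => Integrable.bdd_mul (c := 1)
      (ContinuousOn.integrableOn_compact hK (Real.continuous_exp.comp_continuousOn
        ((hω.const_mul γ).sub (hd.const_mul (γ ^ 2 / 2))))) hf.aestronglyMeasurable
      (.of_forall hf1)
  rw [gmc, gmc, ← integral_sub (hint γ) (hint γ')]
  simp_rw [mul_sub]

/-- The second moment of `M^γ(Γ, f) - M^γ'(Γ, f)` as a double integral. -/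
lemma integral_sq_gmc_sub_gmc [IsProbabilityMeasure (ℙ : Measure Ω)]
    (h : IsContGaussianField K Γ C) (hK : IsCompact K)
    {f : EuclideanSpace ℝ (Fin 2) → ℝ} (hf : Measurable f) (hf1 : ∀ z, |f z| ≤ 1) (γ γ' : ℝ) :
    Integrable (fun ω => (gmc K γ C (Γ ω) f - gmc K γ' C (Γ ω) f) ^ 2) (ℙ : Measure Ω) ∧
    Integrable (fun q : EuclideanSpace ℝ (Fin 2) × EuclideanSpace ℝ (Fin 2) =>
      f q.1 * f q.2 * expIncrement γ γ' (C q.1 q.2))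
      ((volume.restrict K).prod (volume.restrict K)) ∧
    ∫ ω, (gmc K γ C (Γ ω) f - gmc K γ' C (Γ ω) f) ^ 2 =
      ∫ q : EuclideanSpace ℝ (Fin 2) × EuclideanSpace ℝ (Fin 2),
        f q.1 * f q.2 * expIncrement γ γ' (C q.1 q.2)
        ∂((volume.restrict K).prod (volume.restrict K)) := by
  have hfin : IsFiniteMeasure (volume.restrict K) :=
    isFiniteMeasure_restrict.2 hK.measure_ne_top
  obtain ⟨B, hB⟩ := h.exists_abs_diag_le hK
  have hmem : ∀ᵐ q ∂((volume.restrict K).prod (volume.restrict K)), q ∈ K ×ˢ K := by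
    rw [Measure.prod_restrict]
    exact ae_restrict_mem (hK.measurableSet.prod hK.measurableSet)
  have hC : AEStronglyMeasurable (fun q : Ω × EuclideanSpace ℝ (Fin 2) => C q.2 q.2)
      ((ℙ : Measure Ω).prod (volume.restrict K)) :=
    (h.continuousOn_diag.aestronglyMeasurable hK.measurableSet).comp_snd
  have hΓ : AEStronglyMeasurable (fun q : Ω × EuclideanSpace ℝ (Fin 2) => Γ q.1 q.2)
      ((ℙ : Measure Ω).prod (volume.restrict K)) := h.1.aestronglyMeasurable
  have hexp : ∀ γ : ℝ, AEStronglyMeasurable (fun q : Ω × EuclideanSpace ℝ (Fin 2) =>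
      exp (γ * Γ q.1 q.2 - γ ^ 2 / 2 * C q.2 q.2)) ((ℙ : Measure Ω).prod (volume.restrict K)) :=
    fun γ => Real.continuous_exp.comp_aestronglyMeasurable
      ((hΓ.const_mul γ).sub (hC.const_mul (γ ^ 2 / 2)))
  obtain ⟨h1, h2, h3⟩ := integral_sq_integral_eq (P := (ℙ : Measure Ω)) (μ := volume.restrict K)
    (H := fun ω z => f z *
      (exp (γ * Γ ω z - γ ^ 2 / 2 * C z z) - exp (γ' * Γ ω z - γ' ^ 2 / 2 * C z z)))
    (B := exp (γ ^ 2 * B) + exp (γ' ^ 2 * B) + 2 * exp (|γ * γ'| * B))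
    ((hf.comp measurable_snd).aestronglyMeasurable.mul ((hexp γ).sub (hexp γ')))
    (hmem.mono fun q hq => (h.integrable_increment_mul_increment hq.1 hq.2 γ γ' _ _).1)
    ((ae_restrict_mem hK.measurableSet).mono fun z hz => by
      obtain ⟨hi, he⟩ := h.integrable_increment_mul_increment hz hz γ γ' (f z) (f z)
      simp_rw [sq (f z * _)]
      refine ⟨hi, he.trans_le ?_⟩
      have hz' := hB z hz
      have h1 : γ ^ 2 * C z z ≤ γ ^ 2 * B := by gcongr; exact (le_abs_self _).trans hz'
      have h2 : γ' ^ 2 * C z z ≤ γ' ^ 2 * B := by gcongr; exact (le_abs_self _).trans hz'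
      have h4 : |expIncrement γ γ' (C z z)| ≤
          exp (γ ^ 2 * B) + exp (γ' ^ 2 * B) + 2 * exp (|γ * γ'| * B) := by
        have h5 : γ * γ' * C z z ≤ |γ * γ'| * B := by
          refine (le_abs_self _).trans ?_
          rw [abs_mul]
          gcongr
        have := Real.exp_le_exp.2 h1
        have := Real.exp_le_exp.2 h2
        have := Real.exp_le_exp.2 h5
        have := Real.exp_pos (γ ^ 2 * C z z)
        have := Real.exp_pos (γ' ^ 2 * C z z)
        have := Real.exp_pos (γ * γ' * C z z)
        rw [expIncrement, abs_le]
        constructor <;> linarith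
      have h5 : f z * f z ≤ 1 := by
        rw [← abs_mul_abs_self]
        exact mul_le_one₀ (hf1 z) (abs_nonneg _) (hf1 z)
      nlinarith [mul_self_nonneg (f z), le_abs_self (expIncrement γ γ' (C z z)),
        abs_nonneg (expIncrement γ γ' (C z z))])
  have hsq : (fun ω => (gmc K γ C (Γ ω) f - gmc K γ' C (Γ ω) f) ^ 2) =ᵐ[(ℙ : Measure Ω)]
      fun ω => (∫ z in K, f z * (exp (γ * Γ ω z - γ ^ 2 / 2 * C z z) -
        exp (γ' * Γ ω z - γ' ^ 2 / 2 * C z z))) ^ 2 :=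
    (h.gmc_sub_gmc_ae_eq hK hf hf1 γ γ').mono fun ω hω => congrArg (· ^ 2) hω
  have hcov : (fun q : EuclideanSpace ℝ (Fin 2) × EuclideanSpace ℝ (Fin 2) =>
      ∫ ω, f q.1 * (exp (γ * Γ ω q.1 - γ ^ 2 / 2 * C q.1 q.1) -
          exp (γ' * Γ ω q.1 - γ' ^ 2 / 2 * C q.1 q.1)) *
        (f q.2 * (exp (γ * Γ ω q.2 - γ ^ 2 / 2 * C q.2 q.2) -
          exp (γ' * Γ ω q.2 - γ' ^ 2 / 2 * C q.2 q.2))))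
      =ᵐ[(volume.restrict K).prod (volume.restrict K)]
      fun q => f q.1 * f q.2 * expIncrement γ γ' (C q.1 q.2) :=
    hmem.mono fun q hq => (h.integrable_increment_mul_increment hq.1 hq.2 γ γ' _ _).2
  refine ⟨h1.congr hsq.symm, h2.congr hcov, ?_⟩
  rw [integral_congr_ae hsq, h3, integral_congr_ae hcov]

end IsContGaussianField

lemma ae_prod_fst_ne_snd {E : Type*} [MeasurableSpace E] [MeasurableEq E]
    (μ ν : Measure E) [SFinite ν] [NullSingletonClass ν] :
    ∀ᵐ q ∂(μ.prod ν), q.1 ≠ q.2 := by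
  have hs : MeasurableSet {q : E × E | ¬ q.1 ≠ q.2} := by
    simp only [ne_eq, not_not]
    exact measurableSet_diagonal (α := E)
  refine (Measure.measure_prod_null hs).2 (.of_forall fun z => ?_)
  refine measure_mono_null (t := {z}) (fun w hw => ?_) (measure_singleton z)
  exact (not_not.1 hw).symm

/-- The increment bound for parameters of the same sign. -/
lemma exists_integral_sq_gmc_sub_gmc_le {m : ℝ} (c : ℝ) (hm : 0 ≤ m) (hm2 : m < 2) :
    ∃ A : ℝ, 0 ≤ A ∧
      ∀ (Ω : Type) (_ : MeasureSpace Ω), IsProbabilityMeasure (ℙ : Measure Ω) →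
      ∀ (Γ : Ω → EuclideanSpace ℝ (Fin 2) → ℝ)
        (C : EuclideanSpace ℝ (Fin 2) → EuclideanSpace ℝ (Fin 2) → ℝ),
        IsContGaussianField (Metric.closedBall (0 : EuclideanSpace ℝ (Fin 2)) 1) Γ C →
        (∀ z ∈ Metric.closedBall (0 : EuclideanSpace ℝ (Fin 2)) 1,
          ∀ w ∈ Metric.closedBall (0 : EuclideanSpace ℝ (Fin 2)) 1,
          z ≠ w → C z w ≤ -Real.log (dist z w) + c) →
        ∀ f : EuclideanSpace ℝ (Fin 2) → ℝ, Measurable f → (∀ z, |f z| ≤ 1) →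
        ∀ γ γ' : ℝ, γ ^ 2 ≤ m → γ' ^ 2 ≤ m → 0 ≤ γ * γ' →
          ∫ ω, (gmc (Metric.closedBall (0 : EuclideanSpace ℝ (Fin 2)) 1) γ C (Γ ω) f -
            gmc (Metric.closedBall (0 : EuclideanSpace ℝ (Fin 2)) 1) γ' C (Γ ω) f) ^ 2 ≤
            A * (γ - γ') ^ 2 := by
  obtain ⟨p, hmp, hp2⟩ := exists_between hm2
  have hp : 0 < p := hm.trans_lt hmp
  obtain ⟨L, hL, hbound⟩ := exists_abs_expIncrement_le hm hmp
  set K := Metric.closedBall (0 : EuclideanSpace ℝ (Fin 2)) 1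
  have hK : IsCompact K := isCompact_closedBall _ _
  have hfin : IsFiniteMeasure ((volume : Measure (EuclideanSpace ℝ (Fin 2))).restrict K) :=
    isFiniteMeasure_restrict.2 hK.measure_ne_top
  set N : EuclideanSpace ℝ (Fin 2) × EuclideanSpace ℝ (Fin 2) → ℝ :=
    fun q => 1 + exp (p * c) * dist q.1 q.2 ^ (-p) with hN
  have hN1 : ∀ q, 1 ≤ N q := fun q => by
    have : 0 ≤ exp (p * c) * dist q.1 q.2 ^ (-p) := by positivity
    simp only [hN]
    linarith
  have hNint : Integrable N ((volume.restrict K).prod (volume.restrict K)) :=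
    (integrable_const 1).add ((integrable_dist_rpow_neg_closedBall hp2).const_mul _)
  refine ⟨L * ∫ q, N q ∂((volume.restrict K).prod (volume.restrict K)),
    mul_nonneg hL.le (integral_nonneg fun q => zero_le_one.trans (hN1 q)), ?_⟩
  intro Ω _ hΩ Γ C h hC f hf hf1 γ γ' hγ hγ' hγγ'
  obtain ⟨-, hi, he⟩ := h.integral_sq_gmc_sub_gmc hK hf hf1 γ γ'
  obtain ⟨hCi, hC0⟩ := h.integral_cov_nonneg hK
  have hmem : ∀ᵐ q ∂((volume.restrict K).prod (volume.restrict K)), q ∈ K ×ˢ K := by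
    rw [Measure.prod_restrict]
    exact ae_restrict_mem (hK.measurableSet.prod hK.measurableSet)
  rw [he]
  calc _ ≤ ∫ q : EuclideanSpace ℝ (Fin 2) × EuclideanSpace ℝ (Fin 2),
        (γ - γ') ^ 2 * (-C q.1 q.2 + L * N q)
        ∂((volume.restrict K).prod (volume.restrict K)) := by
        refine integral_mono_ae hi ((hCi.neg.add (hNint.const_mul L)).const_mul _) ?_
        filter_upwards [hmem, ae_prod_fst_ne_snd (volume.restrict K) (volume.restrict K)]
          with q hq hne
        have hd : 0 < dist q.1 q.2 := dist_pos.2 hne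
        have hexp : exp (p * C q.1 q.2) ≤ N q := by
          calc exp (p * C q.1 q.2) ≤ exp (p * (-Real.log (dist q.1 q.2) + c)) := by
                gcongr
                exact hC q.1 hq.1 q.2 hq.2 hne
            _ = exp (p * c) * dist q.1 q.2 ^ (-p) := by
                rw [Real.rpow_def_of_pos hd, ← Real.exp_add]
                congr 1
                ring
            _ ≤ N q := by simp [hN]
        refine le_trans ?_ (hbound γ γ' _ (N q) hγ hγ' hγγ' (hN1 q) hexp)
        refine (le_abs_self _).trans ?_
        rw [abs_mul, abs_mul]
        exact mul_le_of_le_one_left (abs_nonneg _)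
          (mul_le_one₀ (hf1 _) (abs_nonneg _) (hf1 _))
    _ = (γ - γ') ^ 2 * (-(∫ q : EuclideanSpace ℝ (Fin 2) × EuclideanSpace ℝ (Fin 2), C q.1 q.2
          ∂((volume.restrict K).prod (volume.restrict K))) +
          L * ∫ q, N q ∂((volume.restrict K).prod (volume.restrict K))) := by
        rw [integral_const_mul, integral_add (by exact hCi.neg) (hNint.const_mul L),
          integral_neg, integral_const_mul]
    _ ≤ _ := by
        rw [mul_comm]
        gcongr
        linarith

/-- **Hölder continuity in `γ` of the approximate GMC, uniformly over log-correlated fields.**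
Let `𝔻̄` be the closed unit disk, `c ∈ ℝ` and `I = [a,b] ⊂ (−√2, √2)` a compact interval.
There is a constant `C' > 0`, depending only on `c` and `I`, such that for every continuous
centered Gaussian field `Γ` on `𝔻̄` with covariance kernel `C(z,w) ≤ −log|z−w| + c` off the
diagonal, every measurable `f` with `|f| ≤ 1` and all `γ, γ̃ ∈ I`,
`E[(M^γ(Γ,f) − M^{γ̃}(Γ,f))²] ≤ C' |γ − γ̃|²`. -/
theorem gmc_holder_in_gamma
    (c a b : ℝ) (hab : a ≤ b)
    (hI : Set.Icc a b ⊆ Set.Ioo (-Real.sqrt 2) (Real.sqrt 2)) :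
    ∃ C' > (0 : ℝ),
      ∀ (Ω : Type) (_ : MeasureSpace Ω), IsProbabilityMeasure (ℙ : Measure Ω) →
      ∀ (Γ : Ω → EuclideanSpace ℝ (Fin 2) → ℝ)
        (C : EuclideanSpace ℝ (Fin 2) → EuclideanSpace ℝ (Fin 2) → ℝ),
        IsContGaussianField (Metric.closedBall (0 : EuclideanSpace ℝ (Fin 2)) 1) Γ C →
        (∀ z ∈ Metric.closedBall (0 : EuclideanSpace ℝ (Fin 2)) 1,
          ∀ w ∈ Metric.closedBall (0 : EuclideanSpace ℝ (Fin 2)) 1,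
          z ≠ w → C z w ≤ -Real.log (dist z w) + c) →
        ∀ f : EuclideanSpace ℝ (Fin 2) → ℝ, Measurable f → (∀ z, |f z| ≤ 1) →
        ∀ γ ∈ Set.Icc a b, ∀ γ' ∈ Set.Icc a b,
          (∫⁻ ω, ENNReal.ofReal
              ((gmc (Metric.closedBall (0 : EuclideanSpace ℝ (Fin 2)) 1) γ C (Γ ω) f -
                gmc (Metric.closedBall (0 : EuclideanSpace ℝ (Fin 2)) 1) γ' C (Γ ω) f) ^ 2)) ≤
            ENNReal.ofReal (C' * |γ - γ'| ^ 2) := by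
  have hsq : ∀ x ∈ Set.Icc a b, x ^ 2 ≤ max (a ^ 2) (b ^ 2) := fun x hx => by
    rcases le_total 0 x with h | h
    · exact le_max_of_le_right (by nlinarith [hx.2])
    · exact le_max_of_le_left (by nlinarith [hx.1])
  have hlt : ∀ x ∈ Set.Icc a b, x ^ 2 < 2 := fun x hx => Real.sq_lt.2 (hI hx)
  have hm : 0 ≤ max (a ^ 2) (b ^ 2) := le_max_of_le_left (sq_nonneg a)
  obtain ⟨A, hA, hbound⟩ := exists_integral_sq_gmc_sub_gmc_le c hm
    (max_lt (hlt a ⟨le_rfl, hab⟩) (hlt b ⟨hab, le_rfl⟩))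
  refine ⟨2 * A + 1, by positivity, ?_⟩
  intro Ω _ hΩ Γ C h hC f hf hf1 γ hγ γ' hγ'
  have hK : IsCompact (Metric.closedBall (0 : EuclideanSpace ℝ (Fin 2)) 1) :=
    isCompact_closedBall _ _
  have hint := fun γ γ' : ℝ => (h.integral_sq_gmc_sub_gmc hK hf hf1 γ γ').1
  rw [← ofReal_integral_eq_lintegral_ofReal (hint γ γ') (.of_forall fun _ => sq_nonneg _)]
  refine ENNReal.ofReal_le_ofReal ?_
  rw [sq_abs]
  rcases le_or_gt 0 (γ * γ') with hs | hs
  · refine (hbound Ω _ hΩ Γ C h hC f hf hf1 γ γ' (hsq γ hγ) (hsq γ' hγ') hs).trans ?_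
    gcongr
    linarith
  · have h1 := hbound Ω _ hΩ Γ C h hC f hf hf1 γ 0 (hsq γ hγ) (by simpa using hm) (by simp)
    have h2 := hbound Ω _ hΩ Γ C h hC f hf hf1 γ' 0 (hsq γ' hγ') (by simpa using hm) (by simp)
    refine (integral_mono (hint γ γ') (((hint γ 0).add (hint γ' 0)).const_mul 2)
      fun ω => ?_).trans ?_
    · simp only [Pi.add_apply]
      nlinarith [sq_nonneg (gmc (Metric.closedBall 0 1) γ C (Γ ω) f +
        gmc (Metric.closedBall 0 1) γ' C (Γ ω) f - 2 * gmc (Metric.closedBall 0 1) 0 C (Γ ω) f)]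
    · simp only [Pi.add_apply]
      rw [integral_const_mul, integral_add (hint γ 0) (hint γ' 0)]
      nlinarith [sq_nonneg (γ - γ'), mul_nonneg hA (neg_nonneg.2 hs.le)]
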